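/- arXiv:1909.10979 — 2 statements merged into one kernel-verified Lean document; each statement's English description precedes it below -/
import Mathlib

section
/- Let N ≥ 2 be even and set k = N/2. Let c_1,…,c_{N−1} ∈ {0,1} and suppose there exists a magnetless soliton x : ℝ → ℂ^N with phase α = −1 satisfying the k-wall boundary conditions determined by this c-sequence. Then the c-sequence is one of the following six: (1) c_a = 1 ⟺ a is odd; (2) c_a = 1 ⟺ a is even; (3) c_a = 1 ⟺ a mod 4 ∈ {2, 3}; (4) c_a = 1 ⟺ a mod 4 ∈ {0, 1}; (5) c_a = 1 ⟺ a mod 4 ∈ {1, 2}; (6) c_a = 1 ⟺ a mod 4 ∈ {3, 0}. Moreover, if N is not divisible by 4, then the c-sequence is one of (1) or (2). -/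
open Filter Real Finset

noncomputable section

/-- The simple roots `α_a = e_a - e_{a+1}` for `a = 1,…,N-1` and the affine root
`α_N = e_N - e_1` of `su(N)`, with 1-based index `a`. -/
def suRoot (N a : ℕ) : Fin N → ℝ := fun i =>
  (if (i : ℕ) + 1 = a then 1 else 0) - (if (i : ℕ) + 1 = a % N + 1 then 1 else 0)

/-- The fundamental weights `w_b = e_1 + ⋯ + e_b - (b/N)(e_1 + ⋯ + e_N)` for
`b = 1,…,N-1`, with the conventions `w_0 = w_N = 0` (the formula realizes them). -/
def suWeight (N b : ℕ) : Fin N → ℝ := fun i =>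
  (if (i : ℕ) + 1 ≤ b then 1 else 0) - (b : ℝ) / N

/-- The Weyl vector `ρ = w_1 + ⋯ + w_{N-1}`. -/
def weylVector (N : ℕ) : Fin N → ℝ := fun i => ∑ b ∈ Finset.Icc 1 (N - 1), suWeight N b i

/-- Euclidean inner product on `ℝ^N`. -/
def dotR {N : ℕ} (v w : Fin N → ℝ) : ℝ := ∑ i, v i * w i

/-- Complex-bilinear extension of the Euclidean inner product. -/
def dotC {N : ℕ} (v : Fin N → ℝ) (y : Fin N → ℂ) : ℂ := ∑ i, (v i : ℂ) * y i

/-- A BPS soliton with phase `α`: a differentiable `x : ℝ → ℂ^N` with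
`dx/dz = (α/2) ∑_{a=1}^N exp(α_a ⋅ conj (x z)) α_a`. -/
def IsBPSSoliton (N : ℕ) (α : ℂ) (x : ℝ → Fin N → ℂ) : Prop :=
  ∀ z : ℝ, HasDerivAt x
    (fun i => α / 2 * ∑ a ∈ Finset.Icc 1 N,
      Complex.exp (dotC (suRoot N a) (fun j => (starRingEnd ℂ) (x z j))) * (suRoot N a i : ℂ)) z

/-- A magnetless soliton has vanishing real part. -/
def IsMagnetless (N : ℕ) (x : ℝ → Fin N → ℂ) : Prop :=
  ∀ (z : ℝ) (i : Fin N), (x z i).re = 0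

/-- The `k`-wall boundary conditions determined by a c-sequence `c`:
`x → 2πi ∑_j c_j w_j` at `-∞` and `x → 2πi (k/N) ρ` at `+∞`. -/
def KWallBC (N k : ℕ) (c : ℕ → ℝ) (x : ℝ → Fin N → ℂ) : Prop :=
  Tendsto x atBot (nhds (fun i =>
      2 * (π : ℂ) * Complex.I * ∑ j ∈ Finset.Icc 1 (N - 1), (c j : ℂ) * (suWeight N j i : ℂ)))
  ∧ Tendsto x atTop (nhds (fun i =>
      2 * (π : ℂ) * Complex.I * ((k : ℂ) / N) * (weylVector N i : ℂ)))

/-- The residue of `n` modulo `N`, as a coordinate index. -/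
def cyclicIndex (N : ℕ) (hN : 0 < N) (n : ℕ) : Fin N := ⟨n % N, Nat.mod_lt _ hN⟩

lemma suRoot_apply_cyclicIndex {N j m : ℕ} (hN : 0 < N) (hj : j < N) (hm : m < N) :
    suRoot N (j + 1) (cyclicIndex N hN (m + 1)) =
      (if j = (m + 1) % N then 1 else 0) - (if j = m then 1 else 0) := by
  have key : (m + 1) % N = (j + 1) % N ↔ j = m := by
    constructor
    · intro h
      have h' : m ≡ j [MOD N] := Nat.ModEq.add_right_cancel' 1 h
      exact (Nat.ModEq.eq_of_lt_of_lt h' hm hj).symm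
    · rintro rfl
      rfl
  simp only [suRoot, cyclicIndex, Nat.add_right_cancel_iff, key, eq_comm (a := (m + 1) % N)]

lemma sum_mul_suRoot {N : ℕ} (hN : 0 < N) (f : ℕ → ℂ) {m : ℕ} (hm : m < N) :
    ∑ a ∈ Finset.Icc 1 N, f a * (suRoot N a (cyclicIndex N hN (m + 1)) : ℂ) =
      f ((m + 1) % N + 1) - f (m + 1) := by
  have hIcc : ∑ a ∈ Finset.Icc 1 N, f a * (suRoot N a (cyclicIndex N hN (m + 1)) : ℂ) =
      ∑ j ∈ Finset.range N,
        f (j + 1) * (suRoot N (j + 1) (cyclicIndex N hN (m + 1)) : ℂ) := by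
    rw [Finset.range_eq_Ico, Finset.sum_Ico_add' (fun a => f a * (suRoot N a _ : ℂ)) 0 N 1]
    rfl
  rw [hIcc]
  calc _ = ∑ j ∈ Finset.range N, ((if j = (m + 1) % N then f (j + 1) else 0)
        - (if j = m then f (j + 1) else 0)) := by
        refine Finset.sum_congr rfl fun j hj => ?_
        rw [suRoot_apply_cyclicIndex hN (Finset.mem_range.1 hj) hm]
        split_ifs <;> simp
    _ = _ := by
        rw [Finset.sum_sub_distrib, Finset.sum_ite_eq', Finset.sum_ite_eq',
          if_pos (Finset.mem_range.2 (Nat.mod_lt _ hN)), if_pos (Finset.mem_range.2 hm)]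

lemma dotC_suRoot {N j : ℕ} (hN : 0 < N) (hj : j < N) (v : Fin N → ℂ) :
    dotC (suRoot N (j + 1)) v = v (cyclicIndex N hN j) - v (cyclicIndex N hN (j + 1)) := by
  have h1 : ∀ i : Fin N, (i : ℕ) = j ↔ i = cyclicIndex N hN j := fun i => by
    simp [Fin.ext_iff, cyclicIndex, Nat.mod_eq_of_lt hj]
  have h2 : ∀ i : Fin N, (i : ℕ) = (j + 1) % N ↔ i = cyclicIndex N hN (j + 1) := fun i => by
    rw [Fin.ext_iff, cyclicIndex]
  simp only [dotC, suRoot, Nat.add_right_cancel_iff, h1, h2]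
  simp [sub_mul, Finset.sum_sub_distrib, apply_ite Complex.ofReal]

/-- The angle `α_{n+1} ⋅ Im x`, with the index `n` read modulo `N`. -/
def rootAngle {N : ℕ} (hN : 0 < N) (x : ℝ → Fin N → ℂ) (n : ℕ) (z : ℝ) : ℝ :=
  (x z (cyclicIndex N hN n)).im - (x z (cyclicIndex N hN (n + 1))).im

lemma cyclicIndex_mod {N : ℕ} (hN : 0 < N) (n : ℕ) :
    cyclicIndex N hN (n % N) = cyclicIndex N hN n := by
  simp [cyclicIndex]

lemma cyclicIndex_mod_add_one {N : ℕ} (hN : 0 < N) (n : ℕ) :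
    cyclicIndex N hN (n % N + 1) = cyclicIndex N hN (n + 1) := by
  simp [cyclicIndex]

lemma rootAngle_mod {N : ℕ} (hN : 0 < N) (x : ℝ → Fin N → ℂ) (n : ℕ) :
    rootAngle hN x (n % N) = rootAngle hN x n := by
  funext z
  simp only [rootAngle, cyclicIndex_mod, cyclicIndex_mod_add_one]

lemma rootAngle_add {N : ℕ} (hN : 0 < N) (x : ℝ → Fin N → ℂ) (n : ℕ) :
    rootAngle hN x (n + N) = rootAngle hN x n := by
  rw [← rootAngle_mod hN x (n + N), Nat.add_mod_right, rootAngle_mod]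

lemma exp_dotC_suRoot {N : ℕ} (hN : 0 < N) {x : ℝ → Fin N → ℂ} (hm : IsMagnetless N x)
    (z : ℝ) {j : ℕ} (hj : j < N) :
    Complex.exp (dotC (suRoot N (j + 1)) (fun i => (starRingEnd ℂ) (x z i))) =
      Complex.exp (((-rootAngle hN x j z : ℝ) : ℂ) * Complex.I) := by
  rw [dotC_suRoot hN hj]
  congr 1
  apply Complex.ext <;> simp [rootAngle, hm z]
  ring

lemma IsBPSSoliton.hasDerivAt_apply {N : ℕ} (hN : 0 < N) {x : ℝ → Fin N → ℂ}
    (hx : IsBPSSoliton N (-1) x) (hm : IsMagnetless N x) (n : ℕ) (z : ℝ) :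
    HasDerivAt (fun z => x z (cyclicIndex N hN (n + 1)))
      (-1 / 2 * (Complex.exp (((-rootAngle hN x (n + 1) z : ℝ) : ℂ) * Complex.I) -
        Complex.exp (((-rootAngle hN x n z : ℝ) : ℂ) * Complex.I))) z := by
  have h := hasDerivAt_pi.1 (hx z) (cyclicIndex N hN (n + 1))
  refine h.congr_deriv ?_
  congr 1
  let f : ℕ → ℂ := fun a => Complex.exp (dotC (suRoot N a) (fun i => (starRingEnd ℂ) (x z i)))
  have hsum := sum_mul_suRoot hN f (Nat.mod_lt n hN)
  rw [cyclicIndex_mod_add_one] at hsum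
  have hfs : ∀ j < N, f (j + 1) = Complex.exp (((-rootAngle hN x j z : ℝ) : ℂ) * Complex.I) :=
    fun j hj => exp_dotC_suRoot hN hm z hj
  rw [hfs _ (Nat.mod_lt _ hN), hfs _ (Nat.mod_lt _ hN), Nat.mod_add_mod, rootAngle_mod,
    rootAngle_mod] at hsum
  exact hsum

lemma hasDerivAt_re {g : ℝ → ℂ} {g' : ℂ} {z : ℝ} (h : HasDerivAt g g' z) :
    HasDerivAt (fun t => (g t).re) g'.re z :=
  (Complex.reCLM.hasFDerivAt (x := g z)).comp_hasDerivAt z h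

lemma hasDerivAt_im {g : ℝ → ℂ} {g' : ℂ} {z : ℝ} (h : HasDerivAt g g' z) :
    HasDerivAt (fun t => (g t).im) g'.im z :=
  (Complex.imCLM.hasFDerivAt (x := g z)).comp_hasDerivAt z h

lemma IsBPSSoliton.cos_rootAngle_succ {N : ℕ} (hN : 0 < N) {x : ℝ → Fin N → ℂ}
    (hx : IsBPSSoliton N (-1) x) (hm : IsMagnetless N x) (n : ℕ) (z : ℝ) :
    cos (rootAngle hN x (n + 1) z) = cos (rootAngle hN x n z) := by
  have h := hasDerivAt_re (hx.hasDerivAt_apply hN hm n z)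
  simp only [hm _ _] at h
  have h0 := h.unique (hasDerivAt_const z (0 : ℝ))
  rw [show (-1 / 2 : ℂ) = ((-1 / 2 : ℝ) : ℂ) by push_cast; ring, Complex.re_ofReal_mul,
    Complex.sub_re, Complex.exp_ofReal_mul_I_re, Complex.exp_ofReal_mul_I_re, cos_neg,
    cos_neg] at h0
  linarith

lemma IsBPSSoliton.hasDerivAt_rootAngle {N : ℕ} (hN : 0 < N) {x : ℝ → Fin N → ℂ}
    (hx : IsBPSSoliton N (-1) x) (hm : IsMagnetless N x) (n : ℕ) (z : ℝ) :
    HasDerivAt (rootAngle hN x (n + 1))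
      (sin (rootAngle hN x (n + 1) z) -
        (sin (rootAngle hN x n z) + sin (rootAngle hN x (n + 2) z)) / 2) z := by
  have h1 := hasDerivAt_im (hx.hasDerivAt_apply hN hm n z)
  have h2 := hasDerivAt_im (hx.hasDerivAt_apply hN hm (n + 1) z)
  rw [show (-1 / 2 : ℂ) = ((-1 / 2 : ℝ) : ℂ) by push_cast; ring, Complex.im_ofReal_mul,
    Complex.sub_im, Complex.exp_ofReal_mul_I_im, Complex.exp_ofReal_mul_I_im, sin_neg,
    sin_neg] at h1 h2
  refine (h1.sub h2).congr_deriv ?_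
  ring

lemma suWeight_sub {N n b : ℕ} (hN : 0 < N) (hn : n + 1 < N) :
    suWeight N b (cyclicIndex N hN n) - suWeight N b (cyclicIndex N hN (n + 1)) =
      if b = n + 1 then 1 else 0 := by
  simp only [suWeight, cyclicIndex, Nat.mod_eq_of_lt hn, Nat.mod_eq_of_lt (Nat.lt_of_succ_lt hn)]
  split_ifs <;> first | omega | ring

lemma tendsto_rootAngle {N : ℕ} (hN : 0 < N) {x : ℝ → Fin N → ℂ} {l : Filter ℝ}
    {v : Fin N → ℂ} (h : Tendsto x l (nhds v)) (n : ℕ) :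
    Tendsto (rootAngle hN x n) l
      (nhds ((v (cyclicIndex N hN n)).im - (v (cyclicIndex N hN (n + 1))).im)) := by
  have h' := tendsto_pi_nhds.1 h
  exact ((Complex.continuous_im.tendsto _).comp (h' _)).sub
    ((Complex.continuous_im.tendsto _).comp (h' _))

lemma im_two_pi_I_mul (r : ℝ) : (2 * (π : ℂ) * Complex.I * (r : ℂ)).im = 2 * π * r := by
  rw [show 2 * (π : ℂ) * Complex.I * (r : ℂ) = ((2 * π * r : ℝ) : ℂ) * Complex.I by
    push_cast; ring, Complex.im_ofReal_mul, Complex.I_im, mul_one]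

lemma KWallBC.tendsto_atBot {N k : ℕ} {c : ℕ → ℝ} {x : ℝ → Fin N → ℂ} (h : KWallBC N k c x)
    (hN : 0 < N) {n : ℕ} (hn : n + 1 < N) :
    Tendsto (rootAngle hN x n) atBot (nhds (2 * π * c (n + 1))) := by
  convert tendsto_rootAngle hN h.1 n using 2
  have key : ∀ i : Fin N, (∑ j ∈ Finset.Icc 1 (N - 1), (c j : ℂ) * (suWeight N j i : ℂ)) =
      ((∑ j ∈ Finset.Icc 1 (N - 1), c j * suWeight N j i : ℝ) : ℂ) := fun i => by push_cast; rfl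
  rw [key, key, im_two_pi_I_mul, im_two_pi_I_mul, ← mul_sub, ← Finset.sum_sub_distrib]
  simp only [← mul_sub, suWeight_sub hN hn, mul_ite, mul_one, mul_zero]
  rw [Finset.sum_ite_eq', if_pos (Finset.mem_Icc.2 ⟨by omega, by omega⟩)]

lemma KWallBC.tendsto_atTop {N k : ℕ} {c : ℕ → ℝ} {x : ℝ → Fin N → ℂ} (h : KWallBC N k c x)
    (hN : 0 < N) {n : ℕ} (hn : n + 1 < N) :
    Tendsto (rootAngle hN x n) atTop (nhds (2 * π * (k / N))) := by
  convert tendsto_rootAngle hN h.2 n using 2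
  have key : ∀ i : Fin N, 2 * (π : ℂ) * Complex.I * ((k : ℂ) / N) * (weylVector N i : ℂ) =
      2 * (π : ℂ) * Complex.I * (((k : ℝ) / N * weylVector N i : ℝ) : ℂ) :=
    fun i => by push_cast; ring
  rw [key, key, im_two_pi_I_mul, im_two_pi_I_mul, ← mul_sub, ← mul_sub, weylVector, weylVector,
    ← Finset.sum_sub_distrib]
  simp only [suWeight_sub hN hn]
  rw [Finset.sum_ite_eq', if_pos (Finset.mem_Icc.2 ⟨by omega, by omega⟩), mul_one]

lemma eq_of_abs_deriv_le_abs_sin {f f' : ℝ → ℝ} {K z₀ : ℝ} (hK : 0 ≤ K)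
    (hf : ∀ z, HasDerivAt f (f' z) z) (hb : ∀ z, |f' z| ≤ K * |sin (f z)|)
    (h0 : sin (f z₀) = 0) (z : ℝ) : f z = f z₀ := by
  have hb' : ∀ t, |f' t| ≤ K * |f t - f z₀| := fun t => by
    refine (hb t).trans (mul_le_mul_of_nonneg_left ?_ hK)
    simpa [h0] using abs_sin_sub_sin_le (f t) (f z₀)
  rcases le_total z₀ z with h | h
  · have hd : ∀ t, HasDerivAt (fun t => f t - f z₀) (f' t) t := fun t => (hf t).sub_const _
    exact sub_eq_zero.1 (eq_zero_of_abs_deriv_le_mul_abs_self_of_eq_zero_right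
      (fun t _ => (hd t).continuousAt.continuousWithinAt) (fun t _ => (hd t).hasDerivWithinAt)
      (sub_self _) (fun t _ => hb' t) z ⟨h, le_rfl⟩)
  · have hd : ∀ t, HasDerivAt (fun t => f (-t) - f z₀) (-f' (-t)) t := fun t => by
      simpa using ((hf (-t)).scomp t (hasDerivAt_neg t)).sub_const (f z₀)
    have := eq_zero_of_abs_deriv_le_mul_abs_self_of_eq_zero_right (a := -z₀) (b := -z) (K := K)
      (fun t _ => (hd t).continuousAt.continuousWithinAt) (fun t _ => (hd t).hasDerivWithinAt)
      (by simp) (fun t _ => by simpa using hb' (-t)) (-z) ⟨neg_le_neg h, le_rfl⟩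
    simpa [sub_eq_zero] using this

lemma exists_eq_of_lt_of_tendsto {f : ℝ → ℝ} (hf : Continuous f) {F : Filter ℝ} [F.NeBot]
    {l v z₀ : ℝ} (hl : Tendsto f F (nhds l)) (h0 : f z₀ < v) (hv : v < l) : ∃ z, f z = v := by
  obtain ⟨z₁, hz₁⟩ := (hl.eventually (lt_mem_nhds hv)).exists
  exact mem_range_of_exists_le_of_exists_ge hf ⟨z₀, h0.le⟩ ⟨z₁, hz₁.le⟩

lemma exists_eq_of_gt_of_tendsto {f : ℝ → ℝ} (hf : Continuous f) {F : Filter ℝ} [F.NeBot]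
    {l v z₀ : ℝ} (hl : Tendsto f F (nhds l)) (h0 : v < f z₀) (hv : l < v) : ∃ z, f z = v := by
  obtain ⟨z₁, hz₁⟩ := (hl.eventually (gt_mem_nhds hv)).exists
  exact mem_range_of_exists_le_of_exists_ge hf ⟨z₁, hz₁.le⟩ ⟨z₀, h0.le⟩

lemma eq_one_iff_sin_neg {f : ℝ → ℝ} (hf : Continuous f) (hs : ∀ z, sin (f z) ≠ 0) {c : ℝ}
    (hc : c = 0 ∨ c = 1) (hbot : Tendsto f atBot (nhds (2 * π * c)))
    (htop : Tendsto f atTop (nhds π)) (z : ℝ) : c = 1 ↔ sin (f z) < 0 := by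
  have hpi := pi_pos
  have h0 : ∀ t, f t ≠ 0 := fun t h => hs t (by simp [h])
  have h1 : ∀ t, f t ≠ π := fun t h => hs t (by simp [h])
  have h2 : ∀ t, f t ≠ 2 * π := fun t h => hs t (by simp [h])
  rcases hc with rfl | rfl
  · have hlo : 0 < f z := by
      refine (h0 z).lt_or_gt.resolve_left fun h => ?_
      obtain ⟨t, ht⟩ := exists_eq_of_lt_of_tendsto hf htop h hpi
      exact h0 t ht
    have hhi : f z < π := by
      refine (h1 z).lt_or_gt.resolve_right fun h => ?_
      obtain ⟨t, ht⟩ := exists_eq_of_gt_of_tendsto hf hbot h (by linarith)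
      exact h1 t ht
    have := sin_pos_of_pos_of_lt_pi hlo hhi
    simp [this.le]
  · have hlo : π < f z := by
      refine (h1 z).lt_or_gt.resolve_left fun h => ?_
      obtain ⟨t, ht⟩ := exists_eq_of_lt_of_tendsto hf hbot h (by linarith)
      exact h1 t ht
    have hhi : f z < 2 * π := by
      refine (h2 z).lt_or_gt.resolve_right fun h => ?_
      obtain ⟨t, ht⟩ := exists_eq_of_gt_of_tendsto hf htop h (by linarith)
      exact h2 t ht
    have : sin (f z) < 0 := by
      rw [← sin_sub_two_pi]
      exact sin_neg_of_neg_of_neg_pi_lt (by linarith) (by linarith)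
    simp [this]

lemma alternating_or_antiperiodic {s : ℕ → ℝ} {N : ℕ} (hN : 0 < N)
    (hne : s 0 ≠ 0) (hsq : ∀ n, s (n + 1) ^ 2 = s n ^ 2)
    (hprod : ∀ n, s (n + 1) * s n = s (n + 2) * s (n + 3))
    (hd : s N - (s (N - 1) + s (N + 1)) / 2 ≠ 0) :
    (∀ n, s (n + 1) = -s n) ∨ (∀ n, s (n + 2) = -s n) := by
  have hne' : ∀ n, s n ≠ 0 := fun n => by
    induction n with
    | zero => exact hne
    | succ n ih =>
      intro h
      have := hsq n
      rw [h] at this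
      exact ih (by simpa using this.symm)
  have hpm : ∀ n, s (n + 1) = s n ∨ s (n + 1) = -s n := fun n => sq_eq_sq_iff_eq_or_eq_neg.1 (hsq n)
  have step : ∀ n, (s (n + 1) = s n ↔ s (n + 3) = s (n + 2)) := fun n => by
    have hp := hprod n
    constructor
    · intro h
      refine (hpm (n + 2)).resolve_right fun h3 => ?_
      simp only [Nat.add_assoc, Nat.reduceAdd] at h3
      rw [h, h3] at hp
      nlinarith [sq_pos_of_ne_zero (hne' n), sq_nonneg (s (n + 2))]
    · intro h
      refine (hpm n).resolve_right fun h3 => ?_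
      rw [h, h3] at hp
      nlinarith [sq_pos_of_ne_zero (hne' n), sq_nonneg (s (n + 2))]
  have hmod : ∀ n, (s (n + 1) = s n ↔ s (n % 2 + 1) = s (n % 2)) := fun n => by
    induction n using Nat.strong_induction_on with
    | _ n ih =>
      rcases lt_or_ge n 2 with h | h
      · rw [Nat.mod_eq_of_lt h]
      · obtain ⟨m, rfl⟩ := Nat.exists_eq_add_of_le' h
        rw [← step m, ih m (by omega), Nat.add_mod_right]
  by_cases h0 : s 1 = s 0 <;> by_cases h1 : s 2 = s 1
  · exfalso
    have hall : ∀ n, s (n + 1) = s n := fun n => by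
      rw [hmod n]
      rcases Nat.mod_two_eq_zero_or_one n with h | h <;> simp [h, h0, h1]
    apply hd
    have := hall (N - 1)
    rw [Nat.sub_add_cancel hN] at this
    rw [hall N, this]
    ring
  · right
    intro n
    have hm := hmod n
    have hm' := hmod (n + 1)
    rcases Nat.mod_two_eq_zero_or_one n with h | h
    · rw [h] at hm
      rw [show (n + 1) % 2 = 1 by omega] at hm'
      rw [(hpm (n + 1)).resolve_left (fun e => h1 (hm'.1 e)), hm.2 h0]
    · rw [h] at hm
      rw [show (n + 1) % 2 = 0 by omega] at hm'
      rw [hm'.2 h0, (hpm n).resolve_left (fun e => h1 (hm.1 e))]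
  · right
    intro n
    have hm := hmod n
    have hm' := hmod (n + 1)
    rcases Nat.mod_two_eq_zero_or_one n with h | h
    · rw [h] at hm
      rw [show (n + 1) % 2 = 1 by omega] at hm'
      rw [hm'.2 h1, (hpm n).resolve_left (fun e => h0 (hm.1 e))]
    · rw [h] at hm
      rw [show (n + 1) % 2 = 0 by omega] at hm'
      rw [(hpm (n + 1)).resolve_left (fun e => h0 (hm'.1 e)), hm.2 h1]
  · left
    intro n
    refine (hpm n).resolve_left fun e => ?_
    rw [hmod n] at e
    rcases Nat.mod_two_eq_zero_or_one n with h | h <;> rw [h] at e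
    exacts [h0 e, h1 e]

lemma neg_iff_of_alternating {s : ℕ → ℝ} (h0 : s 0 ≠ 0) (h : ∀ n, s (n + 1) = -s n) :
    (∀ n, s n < 0 ↔ Odd (n + 1)) ∨ (∀ n, s n < 0 ↔ Even (n + 1)) := by
  have hp : ∀ n, s n = (-1) ^ n * s 0 := fun n => by
    induction n with
    | zero => simp
    | succ n ih => rw [h, ih]; ring
  rcases h0.lt_or_gt with h0 | h0
  · left
    intro n
    rw [hp]
    rcases Nat.even_or_odd n with e | e
    · simp [e.neg_one_pow, h0, e.add_one]
    · simp [e.neg_one_pow, h0.le, Nat.not_odd_iff_even.2 e.add_one]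
  · right
    intro n
    rw [hp]
    rcases Nat.even_or_odd n with e | e
    · simp [e.neg_one_pow, h0.le, Nat.not_even_iff_odd.2 e.add_one]
    · simp [e.neg_one_pow, h0, e.add_one]

lemma neg_iff_of_antiperiodic {s : ℕ → ℝ} (h0 : s 0 ≠ 0) (h1 : s 1 ≠ 0)
    (h : ∀ n, s (n + 2) = -s n) :
    (∀ n, s n < 0 ↔ ((n + 1) % 4 = 2 ∨ (n + 1) % 4 = 3)) ∨
    (∀ n, s n < 0 ↔ ((n + 1) % 4 = 0 ∨ (n + 1) % 4 = 1)) ∨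
    (∀ n, s n < 0 ↔ ((n + 1) % 4 = 1 ∨ (n + 1) % 4 = 2)) ∨
    (∀ n, s n < 0 ↔ ((n + 1) % 4 = 3 ∨ (n + 1) % 4 = 0)) := by
  have hmod : ∀ n, s n = s (n % 4) := fun n => by
    induction n using Nat.strong_induction_on with
    | _ n ih =>
      rcases lt_or_ge n 4 with h4 | h4
      · rw [Nat.mod_eq_of_lt h4]
      · obtain ⟨m, rfl⟩ := Nat.exists_eq_add_of_le' h4
        rw [Nat.add_mod_right, ← ih m (by omega), show m + 4 = m + 2 + 2 from rfl, h, h, neg_neg]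
  have h2 : s 2 = -s 0 := h 0
  have h3 : s 3 = -s 1 := h 1
  have main : ∀ P : ℕ → Prop, (s 0 < 0 ↔ P 1) → (s 1 < 0 ↔ P 2) → (s 2 < 0 ↔ P 3) →
      (s 3 < 0 ↔ P 0) → ∀ n, s n < 0 ↔ P ((n + 1) % 4) := by
    intro P p0 p1 p2 p3 n
    rw [hmod n]
    have : n % 4 < 4 := Nat.mod_lt _ (by norm_num)
    rw [Nat.add_mod]
    interval_cases n % 4 <;> simpa
  rcases h0.lt_or_gt with h0 | h0 <;> rcases h1.lt_or_gt with h1 | h1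
  · right; right; left
    exact main (fun r => r = 1 ∨ r = 2) (by simp [h0]) (by simp [h1]) (by simp [h2, h0.le])
      (by simp [h3, h1.le])
  · right; left
    exact main (fun r => r = 0 ∨ r = 1) (by simp [h0]) (by simp [h1.le]) (by simp [h2, h0.le])
      (by simp [h3, h1])
  · left
    exact main (fun r => r = 2 ∨ r = 3) (by simp [h0.le]) (by simp [h1]) (by simp [h2, h0])
      (by simp [h3, h1.le])
  · right; right; right
    exact main (fun r => r = 3 ∨ r = 0) (by simp [h0.le]) (by simp [h1.le]) (by simp [h2, h0])
      (by simp [h3, h1])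

lemma mod_four_eq_zero_of_antiperiodic {s : ℕ → ℝ} (h0 : s 0 ≠ 0) (h : ∀ n, s (n + 2) = -s n)
    {N : ℕ} (hN : Even N) (hper : s N = s 0) : N % 4 = 0 := by
  obtain ⟨m, rfl⟩ := hN
  have hp : ∀ m, s (m + m) = (-1) ^ m * s 0 := fun m => by
    induction m with
    | zero => simp
    | succ m ih => rw [show m + 1 + (m + 1) = m + m + 2 by ring, h, ih]; ring
  rcases Nat.even_or_odd m with e | e
  · obtain ⟨r, rfl⟩ := e
    omega
  · have := hp m
    rw [hper, e.neg_one_pow] at this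
    exact absurd (by linarith) h0

/-- For a magnetless soliton with the `N/2`-wall boundary conditions, the values `s n` of the sines
of the root angles at a suitable point have the signs prescribed by the c-sequence, and are either
alternating or antiperiodic with antiperiod two. -/
lemma exists_sign_sequence {N : ℕ} (hN : 2 ≤ N) (hNeven : Even N) {c : ℕ → ℝ}
    (hc : ∀ j ∈ Finset.Icc 1 (N - 1), c j = 0 ∨ c j = 1) {x : ℝ → Fin N → ℂ}
    (hx : IsBPSSoliton N (-1) x) (hm : IsMagnetless N x) (hbc : KWallBC N (N / 2) c x) :
    ∃ s : ℕ → ℝ, (∀ n, s n ≠ 0) ∧ s N = s 0 ∧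
      (∀ a ∈ Finset.Icc 1 (N - 1), (c a = 1 ↔ s (a - 1) < 0)) ∧
      ((∀ n, s (n + 1) = -s n) ∨ (∀ n, s (n + 2) = -s n)) := by
  have hN0 : 0 < N := by omega
  set θ := rootAngle hN0 x
  have hper : ∀ n, θ (n + N) = θ n := rootAngle_add hN0 x
  have hder : ∀ n z, HasDerivAt (θ (n + 1))
      (sin (θ (n + 1) z) - (sin (θ n z) + sin (θ (n + 2) z)) / 2) z :=
    hx.hasDerivAt_rootAngle hN0 hm
  have hsq : ∀ n z, sin (θ (n + 1) z) ^ 2 = sin (θ n z) ^ 2 := fun n z => by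
    rw [sin_sq, sin_sq, hx.cos_rootAngle_succ hN0 hm]
  have hsq0 : ∀ n z, sin (θ n z) ^ 2 = sin (θ 0 z) ^ 2 := fun n z => by
    induction n with
    | zero => rfl
    | succ n ih => rw [hsq, ih]
  have habs : ∀ n z, |sin (θ n z)| = |sin (θ 0 z)| := fun n z => sq_eq_sq_iff_abs_eq_abs _ _ |>.1
    (hsq0 n z)
  have hθN : θ N = θ 0 := by simpa using hper 0
  have hder0 : ∀ z, HasDerivAt (θ 0)
      (sin (θ N z) - (sin (θ (N - 1) z) + sin (θ (N + 1) z)) / 2) z := fun z => by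
    have := hder (N - 1) z
    rw [← hθN]
    rwa [show N - 1 + 2 = N + 1 by omega, Nat.sub_add_cancel (show 1 ≤ N by omega)] at this
  have hcont : ∀ n, Continuous (θ n) := fun n => by
    rw [← hper, show n + N = n + (N - 1) + 1 by omega]
    exact continuous_iff_continuousAt.2 fun z => (hder _ z).continuousAt
  have hbot : ∀ n, n + 1 < N → Tendsto (θ n) atBot (nhds (2 * π * c (n + 1))) :=
    fun n hn => hbc.tendsto_atBot hN0 hn
  have htop : ∀ n, n + 1 < N → Tendsto (θ n) atTop (nhds π) := fun n hn => by
    convert hbc.tendsto_atTop hN0 hn using 2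
    obtain ⟨m, rfl⟩ := hNeven
    have : (m : ℝ) ≠ 0 := by
      have : m ≠ 0 := by omega
      exact_mod_cast this
    rw [show (m + m) / 2 = m by omega]
    push_cast
    field_simp
    ring
  have hnotconst : ¬ ∃ r, ∀ z, θ 0 z = r := by
    rintro ⟨r, hr⟩
    have hθr : θ 0 = fun _ => r := funext hr
    have h1 := hbot 0 (by omega)
    have h2 := htop 0 (by omega)
    rw [hθr] at h1 h2
    have e1 := tendsto_nhds_unique h1 tendsto_const_nhds
    have e2 := tendsto_nhds_unique h2 tendsto_const_nhds
    have hpi := pi_pos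
    rcases hc 1 (Finset.mem_Icc.2 ⟨le_rfl, by omega⟩) with h | h <;>
      simp only [zero_add, h] at e1 <;> linarith
  have hs0 : ∀ z, sin (θ 0 z) ≠ 0 := fun z₀ h0 => by
    refine hnotconst ⟨θ 0 z₀, eq_of_abs_deriv_le_abs_sin (K := 2) (by norm_num) hder0 (fun z => ?_)
      h0⟩
    have e1 := abs_le.1 (habs N z).le
    have e2 := abs_le.1 (habs (N - 1) z).le
    have e3 := abs_le.1 (habs (N + 1) z).le
    rw [abs_le]
    constructor <;> linarith [e1.1, e1.2, e2.1, e2.2, e3.1, e3.2]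
  have hs : ∀ n z, sin (θ n z) ≠ 0 := fun n z h => hs0 z (by
    have := habs n z
    rw [h, abs_zero] at this
    exact abs_eq_zero.1 this.symm)
  obtain ⟨z, hz⟩ : ∃ z, sin (θ N z) - (sin (θ (N - 1) z) + sin (θ (N + 1) z)) / 2 ≠ 0 := by
    by_contra! hcon
    refine hnotconst ⟨θ 0 0, fun z => is_const_of_deriv_eq_zero
      (fun t => (hder0 t).differentiableAt) (fun t => ?_) z 0⟩
    rw [(hder0 t).deriv, hcon]
  refine ⟨fun n => sin (θ n z), fun n => hs n z, by simp only [hθN], fun a ha => ?_, ?_⟩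
  · obtain ⟨h1, h2⟩ := Finset.mem_Icc.1 ha
    have hb := hbot (a - 1) (by omega)
    rw [Nat.sub_add_cancel h1] at hb
    exact eq_one_iff_sin_neg (hcont _) (hs _) (hc a ha) hb (htop _ (by omega)) z
  · refine alternating_or_antiperiodic (s := fun n => sin (θ n z)) hN0 (hs 0 z)
      (fun n => hsq n z) (fun n => ?_) hz
    have hcos : (fun t => cos (θ (n + 1 + 1) t)) = fun t => cos (θ (n + 1) t) :=
      funext fun t => hx.cos_rootAngle_succ hN0 hm (n + 1) t
    have d1 := (hder n z).cos
    have d2 := (hder (n + 1) z).cos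
    rw [hcos] at d2
    have := d1.unique d2
    simp only [Nat.add_assoc, Nat.reduceAdd] at this
    have hq := hsq (n + 1) z
    simp only [Nat.add_assoc, Nat.reduceAdd] at hq
    linarith

/-- classification of the c-sequences admitting magnetless solitons
(Theorem 5 of the paper): at most six boundary conditions, and only two when
`N` is not divisible by 4. -/
theorem magnetless_boundary_classification (N : ℕ) (hN : 2 ≤ N) (hNeven : Even N)
    (c : ℕ → ℝ) (hc : ∀ j ∈ Finset.Icc 1 (N - 1), c j = 0 ∨ c j = 1)
    (hex : ∃ x : ℝ → Fin N → ℂ,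
      IsBPSSoliton N (-1) x ∧ IsMagnetless N x ∧ KWallBC N (N / 2) c x) :
    ((∀ a ∈ Finset.Icc 1 (N - 1), (c a = 1 ↔ Odd a)) ∨
     (∀ a ∈ Finset.Icc 1 (N - 1), (c a = 1 ↔ Even a)) ∨
     (∀ a ∈ Finset.Icc 1 (N - 1), (c a = 1 ↔ (a % 4 = 2 ∨ a % 4 = 3))) ∨
     (∀ a ∈ Finset.Icc 1 (N - 1), (c a = 1 ↔ (a % 4 = 0 ∨ a % 4 = 1))) ∨
     (∀ a ∈ Finset.Icc 1 (N - 1), (c a = 1 ↔ (a % 4 = 1 ∨ a % 4 = 2))) ∨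
     (∀ a ∈ Finset.Icc 1 (N - 1), (c a = 1 ↔ (a % 4 = 3 ∨ a % 4 = 0)))) ∧
    (N % 4 ≠ 0 →
      ((∀ a ∈ Finset.Icc 1 (N - 1), (c a = 1 ↔ Odd a)) ∨
       (∀ a ∈ Finset.Icc 1 (N - 1), (c a = 1 ↔ Even a)))) := by
  obtain ⟨x, hx, hm, hbc⟩ := hex
  obtain ⟨s, hs, hper, hcs, hpat⟩ := exists_sign_sequence hN hNeven hc hx hm hbc
  have transfer : ∀ P : ℕ → Prop, (∀ n, s n < 0 ↔ P (n + 1)) →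
      ∀ a ∈ Finset.Icc 1 (N - 1), (c a = 1 ↔ P a) := fun P hP a ha => by
    rw [hcs a ha, hP, Nat.sub_add_cancel (Finset.mem_Icc.1 ha).1]
  rcases hpat with h | h
  · have h2 := (neg_iff_of_alternating (hs 0) h).imp (transfer _) (transfer _)
    exact ⟨h2.imp_right Or.inl, fun _ => h2⟩
  · exact ⟨Or.inr (Or.inr ((neg_iff_of_antiperiodic (hs 0) (hs 1) h).imp
      (transfer (fun a => a % 4 = 2 ∨ a % 4 = 3))
      (Or.imp (transfer (fun a => a % 4 = 0 ∨ a % 4 = 1))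
        (Or.imp (transfer (fun a => a % 4 = 1 ∨ a % 4 = 2))
          (transfer (fun a => a % 4 = 3 ∨ a % 4 = 0)))))),
      fun h4 => absurd (mod_four_eq_zero_of_antiperiodic (hs 0) h hNeven hper) h4⟩
end
end

section
/- Let N ≥ 2 be even and let α_a = e_a − e_{a+1} for a = 1,…,N−1 and α_N = e_N − e_1 in ℝ^N. Define f : ℝ → ℝ by f(z) = 2π − 2·arctan(e^{2z}) and define σ : ℝ → ℝ^N componentwise (1-indexed) by σ_i(z) = (−1)^{i+1} f(z)/2 − 2π·⌊(i−1)/2⌋. Then: (i) f′(z) = 2 sin(f(z)) for all z; (ii) for every a = 1,…,N, sin(α_a · σ(z)) = sin(f(z)) if a is odd and sin(α_a · σ(z)) = −sin(f(z)) if a is even; (iii) σ satisfies the magnetless BPS equation dσ/dz = (1/2) Σ_{a=1}^N sin(α_a · σ(z)) α_a for all z ∈ ℝ. -/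
open Finset

noncomputable section

theorem dotR_suRoot {N a : ℕ} (ha : 1 ≤ a) (haN : a ≤ N) (v : Fin N → ℝ) :
    dotR (suRoot N a) v = v ⟨a - 1, by omega⟩ - v ⟨a % N, Nat.mod_lt _ (by omega)⟩ := by
  have h₁ : ∀ i : Fin N, ((i : ℕ) + 1 = a) ↔ i = ⟨a - 1, by omega⟩ := by
    intro i
    rw [Fin.ext_iff]
    dsimp only
    omega
  have h₂ : ∀ i : Fin N,
      ((i : ℕ) + 1 = a % N + 1) ↔ i = ⟨a % N, Nat.mod_lt _ (by omega)⟩ := by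
    intro i
    rw [Fin.ext_iff]
    dsimp only
    omega
  simp only [dotR, suRoot, h₁, h₂, sub_mul, ite_mul, one_mul, zero_mul, Finset.sum_sub_distrib,
    Finset.sum_ite_eq', Finset.mem_univ, if_true]

theorem sum_mul_suRoot_s17 {N : ℕ} (s : ℕ → ℝ) (j : Fin N) :
    ∑ a ∈ Finset.Icc 1 N, s a * suRoot N a j =
      s (j + 1) - s (if (j : ℕ) = 0 then N else j) := by
  have hj := j.isLt
  have h : ∀ a ∈ Finset.Icc 1 N, s a * suRoot N a j =
      (if a = (j : ℕ) + 1 then s a else 0) -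
        (if a = (if (j : ℕ) = 0 then N else j) then s a else 0) := by
    intro a ha
    rw [Finset.mem_Icc] at ha
    have h₂ : ((j : ℕ) + 1 = a % N + 1) ↔ a = (if (j : ℕ) = 0 then N else j) := by
      rcases ha.2.eq_or_lt with rfl | h
      · rw [Nat.mod_self]
        split_ifs <;> omega
      · rw [Nat.mod_eq_of_lt h]
        split_ifs <;> omega
    simp only [suRoot, h₂, eq_comm (a := (j : ℕ) + 1), mul_sub, mul_ite, mul_one, mul_zero]
  rw [Finset.sum_congr rfl h, Finset.sum_sub_distrib, Finset.sum_ite_eq', Finset.sum_ite_eq',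
    if_pos (Finset.mem_Icc.2 ⟨by omega, by omega⟩), if_pos]
  rw [Finset.mem_Icc]
  split_ifs <;> omega

theorem sin_two_mul_arctan (x : ℝ) : Real.sin (2 * Real.arctan x) = 2 * x / (1 + x ^ 2) := by
  have h : (0 : ℝ) < 1 + x ^ 2 := by positivity
  rw [Real.sin_two_mul, Real.sin_arctan, Real.cos_arctan]
  field_simp
  rw [Real.sq_sqrt h.le]

theorem hasDerivAt_wallProfile (z : ℝ) :
    HasDerivAt (fun z => 2 * Real.pi - 2 * Real.arctan (Real.exp (2 * z)))
      (2 * Real.sin (2 * Real.pi - 2 * Real.arctan (Real.exp (2 * z)))) z := by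
  have h := (((((hasDerivAt_id z).const_mul 2).exp).arctan).const_mul 2).const_sub (2 * Real.pi)
  refine h.congr_deriv ?_
  rw [Real.sin_two_pi_sub, sin_two_mul_arctan]
  simp only [id]
  ring

theorem sin_dotR_suRoot_alternating {N : ℕ} (hNeven : Even N) (t : ℝ) (v : Fin N → ℝ)
    (hv : ∀ j : Fin N,
      v j = (-1 : ℝ) ^ (j : ℕ) * t / 2 - 2 * Real.pi * (((j : ℕ) / 2 : ℕ) : ℝ))
    {a : ℕ} (ha : 1 ≤ a) (haN : a ≤ N) :
    Real.sin (dotR (suRoot N a) v) = if Odd a then Real.sin t else -Real.sin t := by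
  rw [dotR_suRoot ha haN, hv, hv]
  dsimp only
  split_ifs with hodd
  · obtain ⟨m, rfl⟩ := hodd
    have hlt : 2 * m + 1 < N := by
      obtain ⟨n, rfl⟩ := hNeven
      omega
    rw [Nat.mod_eq_of_lt hlt, Nat.add_sub_cancel, show 2 * m / 2 = m by omega,
      show (2 * m + 1) / 2 = m by omega, pow_succ, pow_mul]
    congr 1
    norm_num
    ring
  · obtain ⟨m, rfl⟩ : ∃ m, a = 2 * m + 2 := by
      rw [Nat.not_odd_iff_even] at hodd
      obtain ⟨n, rfl⟩ := hodd
      exact ⟨n - 1, by omega⟩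
    obtain ⟨q, hq⟩ : ∃ q, (2 * m + 2) % N = 2 * q := by
      obtain ⟨n, rfl⟩ := hNeven
      exact ⟨(m + 1) % n, by
        rw [← two_mul, ← Nat.mul_mod_mul_left, mul_add, mul_one]⟩
    rw [hq, show 2 * m + 2 - 1 = 2 * m + 1 by omega, show 2 * q / 2 = q by omega,
      show (2 * m + 1) / 2 = m by omega, pow_succ, pow_mul, pow_mul, ← Real.sin_neg,
      ← Real.sin_add_int_mul_two_pi (-t) ((q : ℤ) - m)]
    congr 1
    push_cast
    norm_num
    ring

/-- the explicit alternating magnetless `k = N/2` wall solution: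
with `f(z) = 2π - 2 arctan(e^{2z})` and
`σ_i(z) = (-1)^{i+1} f(z)/2 - 2π⌊(i-1)/2⌋` (1-based `i`), one has `f' = 2 sin f`,
`sin(α_a · σ) = ± sin f` according to the parity of `a`, and `σ` satisfies the
magnetless BPS equation `dσ/dz = (1/2) ∑_{a=1}^N sin(α_a · σ) α_a`. -/
theorem alternating_magnetless_solution (N : ℕ) (hN : 2 ≤ N) (hNeven : Even N)
    (f : ℝ → ℝ) (hf : ∀ z, f z = 2 * Real.pi - 2 * Real.arctan (Real.exp (2 * z)))
    (σ : ℝ → Fin N → ℝ)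
    (hσ : ∀ (z : ℝ) (j : Fin N),
      σ z j = (-1 : ℝ) ^ (j : ℕ) * f z / 2 - 2 * Real.pi * (((j : ℕ) / 2 : ℕ) : ℝ)) :
    (∀ z, HasDerivAt f (2 * Real.sin (f z)) z) ∧
    (∀ (z : ℝ), ∀ a ∈ Finset.Icc 1 N,
      Real.sin (dotR (suRoot N a) (σ z)) =
        if Odd a then Real.sin (f z) else -Real.sin (f z)) ∧
    (∀ z : ℝ, HasDerivAt σ
      (fun j => (1 / 2 : ℝ) * ∑ a ∈ Finset.Icc 1 N,
        Real.sin (dotR (suRoot N a) (σ z)) * suRoot N a j) z) := by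
  have hderiv : ∀ z, HasDerivAt f (2 * Real.sin (f z)) z := by
    obtain rfl : f = _ := funext hf
    exact hasDerivAt_wallProfile
  have hsin : ∀ (z : ℝ), ∀ a ∈ Finset.Icc 1 N,
      Real.sin (dotR (suRoot N a) (σ z)) =
        if Odd a then Real.sin (f z) else -Real.sin (f z) := fun z a ha =>
    sin_dotR_suRoot_alternating hNeven (f z) (σ z) (hσ z)
      (Finset.mem_Icc.1 ha).1 (Finset.mem_Icc.1 ha).2
  refine ⟨hderiv, hsin, fun z => hasDerivAt_pi.2 fun j => ?_⟩
  have hσj : (fun z => σ z j) = fun z =>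
      (-1 : ℝ) ^ (j : ℕ) * f z / 2 - 2 * Real.pi * (((j : ℕ) / 2 : ℕ) : ℝ) :=
    funext fun z => hσ z j
  rw [hσj]
  refine ((((hderiv z).const_mul _).div_const 2).sub_const _).congr_deriv ?_
  have hpred : Odd (if (j : ℕ) = 0 then N else j) ↔ Odd (j : ℕ) := by
    split_ifs with h
    · simp [h, hNeven]
    · rfl
  rw [Finset.sum_congr rfl fun a ha => by rw [hsin z a ha],
    sum_mul_suRoot_s17 (fun a => if Odd a then Real.sin (f z) else -Real.sin (f z)) j]
  simp only [hpred, Nat.odd_add_one]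
  by_cases hj : Odd (j : ℕ)
  · simp only [hj, hj.neg_one_pow, not_true, if_true, if_false]
    ring
  · simp only [hj, (Nat.not_odd_iff_even.1 hj).neg_one_pow, not_false_eq_true, if_true, if_false]
    ring
end
end
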